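/- Let n ≥ 3 be an integer and set c := −((⌈n/2⌉ − 1 : ℝ) / ⌈n/2⌉) (which equals cos(2*T(n))). Then for every k with 0 ≤ k ≤ n one has (R_k : ℝ) + c * L_k ≥ 0, and equality holds for k = ⌊n/2⌋, i.e. (R_{⌊n/2⌋} : ℝ) + c * L_{⌊n/2⌋} = 0. -/

import Mathlib

/-- Binomial coefficient `C(a, b)` for integer lower index, with `C(a,b) = 0` for `b < 0`. -/
def C (a : ℕ) (b : ℤ) : ℕ := if b < 0 then 0 else a.choose b.toNat

/-- `R_k = C(n−2, k−2) + C(n−2, k)`. -/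
def R (n k : ℕ) : ℕ := C (n - 2) ((k : ℤ) - 2) + C (n - 2) (k : ℤ)

/-- `L_k = 2·C(n−2, k−1)`. -/
def L (n k : ℕ) : ℕ := 2 * C (n - 2) ((k : ℤ) - 1)

theorem C_natCast (a b : ℕ) : C a (b : ℤ) = a.choose b := by
  simp [C]

/-- `(R_k + L_k) · k(n - k) = n(n - 1) · L_k / 2`, a form of
`C(n, k) · k(n - k) = n(n - 1) · C(n - 2, k - 1)`. -/
theorem R_add_L_mul (n k : ℕ) (hn : 2 ≤ n) (hk : k ≤ n) :
    ((R n k : ℝ) + L n k) * (2 * (k * ((n : ℝ) - k))) = n * ((n : ℝ) - 1) * L n k := by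
  obtain ⟨m, rfl⟩ := Nat.exists_eq_add_of_le' hn
  rcases k with _ | j
  · simp [L, C]
  have hL : L (m + 2) (j + 1) = 2 * m.choose j := by
    rw [L, ← C_natCast]; congr 2; push_cast; ring
  obtain rfl | hj : j = m + 1 ∨ j ≤ m := by omega
  · rw [hL, Nat.choose_succ_self]; push_cast; ring
  have key : ∃ a : ℕ, R (m + 2) (j + 1) = a + m.choose (j + 1) ∧
      (a : ℝ) * ((m : ℝ) - j + 1) = m.choose j * j := by
    rcases j with _ | i
    · exact ⟨0, by simp [R, C], by simp⟩
    · refine ⟨m.choose i, ?_, ?_⟩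
      · rw [R, ← C_natCast, ← C_natCast]; congr 2; push_cast; ring
      · have h := congrArg (Nat.cast (R := ℝ)) (Nat.choose_succ_right_eq m i)
        rw [Nat.cast_mul, Nat.cast_mul, Nat.cast_sub (by omega)] at h
        push_cast at h ⊢
        linarith
  obtain ⟨a, hR, ha⟩ := key
  have hd := congrArg (Nat.cast (R := ℝ)) (Nat.choose_succ_right_eq m j)
  rw [Nat.cast_mul, Nat.cast_mul, Nat.cast_sub hj] at hd
  rw [hR, hL]
  push_cast at hd ⊢
  linear_combination 2 * ((j : ℝ) + 1) * ha + 2 * ((m : ℝ) - j + 1) * hd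

theorem ceil_natCast_div_two (n : ℕ) : ⌈(n : ℝ) / 2⌉ = (((n + 1) / 2 : ℕ) : ℤ) := by
  rw [Int.ceil_eq_iff]
  obtain ⟨p, rfl | rfl⟩ := Nat.even_or_odd' n
  · rw [show (2 * p + 1) / 2 = p by omega]
    push_cast
    constructor <;> linarith
  · rw [show (2 * p + 1 + 1) / 2 = p + 1 by omega]
    push_cast
    constructor <;> linarith

theorem mul_sub_mul_le (n k : ℕ) (hn : 0 < n) :
    (k * ((n : ℝ) - k)) * (4 * ((n + 1) / 2 : ℕ) - 2) ≤ ((n + 1) / 2 : ℕ) * (n * ((n : ℝ) - 1)) := by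
  obtain ⟨p, rfl | rfl⟩ := Nat.even_or_odd' n
  · rw [show (2 * p + 1) / 2 = p by omega]
    rcases p with _ | q
    · simp at hn
    push_cast
    nlinarith [mul_nonneg (show (0 : ℝ) ≤ 4 * q + 2 by positivity)
      (sq_nonneg ((k : ℝ) - (q + 1)))]
  · rw [show (2 * p + 1 + 1) / 2 = p + 1 by omega]
    have h : (0 : ℝ) ≤ ((k : ℝ) - p) * (k - (p + 1)) := by
      rcases le_or_gt k p with h | h
      · have : (k : ℝ) ≤ p := by exact_mod_cast h
        nlinarith
      · have : (p : ℝ) + 1 ≤ k := by exact_mod_cast h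
        nlinarith
    push_cast
    nlinarith [mul_nonneg (show (0 : ℝ) ≤ 4 * p + 2 by positivity) h]

theorem half_mul_sub_half_mul (n : ℕ) :
    (((n / 2 : ℕ) : ℝ) * ((n : ℝ) - (n / 2 : ℕ))) * (4 * ((n + 1) / 2 : ℕ) - 2) =
      ((n + 1) / 2 : ℕ) * (n * ((n : ℝ) - 1)) := by
  obtain ⟨p, rfl | rfl⟩ := Nat.even_or_odd' n
  · rw [show (2 * p + 1) / 2 = p by omega, show 2 * p / 2 = p by omega]
    push_cast
    ring
  · rw [show (2 * p + 1 + 1) / 2 = p + 1 by omega, show (2 * p + 1) / 2 = p by omega]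
    push_cast
    ring

theorem stmt_6 (n : ℕ) (hn : 3 ≤ n)
    (c : ℝ) (hc : c = -(((⌈(n : ℝ) / 2⌉ : ℝ) - 1) / (⌈(n : ℝ) / 2⌉ : ℝ))) :
    (∀ k, k ≤ n → 0 ≤ (R n k : ℝ) + c * (L n k : ℝ)) ∧
      (R n (n / 2) : ℝ) + c * (L n (n / 2) : ℝ) = 0 := by
  rw [ceil_natCast_div_two, Int.cast_natCast] at hc
  have hle := fun k => mul_sub_mul_le n k (by omega)
  have heq := half_mul_sub_half_mul n
  have hpos : (0 : ℝ) < ((n + 1) / 2 : ℕ) := by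
    exact_mod_cast (by omega : 0 < (n + 1) / 2)
  generalize (((n + 1) / 2 : ℕ) : ℝ) = h at hc hle heq hpos
  have hch : c * h = 1 - h := by
    rw [hc]; field_simp; ring
  have key (k : ℕ) (hk : k ≤ n) :
      ((R n k : ℝ) + c * L n k) * (2 * h * (k * ((n : ℝ) - k))) =
        L n k * (h * (n * ((n : ℝ) - 1)) - (k * ((n : ℝ) - k)) * (4 * h - 2)) := by
    linear_combination h * R_add_L_mul n k (by omega) hk +
      2 * (L n k : ℝ) * (k * ((n : ℝ) - k)) * hch
  have hpos' (k : ℕ) (h0 : 0 < k) (hk : k < n) : 0 < 2 * h * (k * ((n : ℝ) - k)) := by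
    have h1 : (0 : ℝ) < k := by exact_mod_cast h0
    have h2 : (0 : ℝ) < (n : ℝ) - k := sub_pos.2 (by exact_mod_cast hk)
    positivity
  refine ⟨fun k hk => ?_, ?_⟩
  · by_cases hb : 0 < k ∧ k < n
    · refine nonneg_of_mul_nonneg_left ?_ (hpos' k hb.1 hb.2)
      rw [key k hk]
      exact mul_nonneg (Nat.cast_nonneg _) (sub_nonneg.2 (hle k))
    · have hL : L n k = 0 := by
        obtain rfl | rfl : k = 0 ∨ k = n := by omega
        · simp [L, C]
        · rw [L, show (k : ℤ) - 1 = ((k - 1 : ℕ) : ℤ) by omega, C_natCast,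
            Nat.choose_eq_zero_of_lt (by omega)]
      simp [hL]
  · have := key (n / 2) (by omega)
    rw [heq, sub_self, mul_zero] at this
    exact (mul_eq_zero.1 this).resolve_right (hpos' _ (by omega) (by omega)).ne'
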